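/- arXiv:2511.18401 — 2 statements merged into one kernel-verified Lean document; each statement's English description precedes it below -/
import Mathlib

section
/- Let G, f : ℂ^n → ℝ be smooth, and let ψ : ℝ × ℂ^n → ℂ^n be smooth with ψ_0 = id, ψ_{s+t} = ψ_s ∘ ψ_t, each ψ_t a bijection of ℂ^n, and ∂_t ψ_t(z) = X_G(ψ_t(z)) for all t, z; assume moreover that for all t and z the differential D_z ψ_t is complex-linear (commutes with multiplication by i) and symplectic. Define H : ℝ × ℂ^n → ℝ by H(t,z) = G(z) + f(ψ_t^{-1}(z)). If u : ℝ² → ℂ^n is smooth and solves the Floer equation for H, then the map ū(s,t) := ψ_t^{-1}(u(s,t)) solves the Floer equation for the autonomous Hamiltonian f, i.e. ∂_s ū = −i(∂_t ū − i∇f(ū)). -/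
noncomputable section

open Complex

/-- The real inner product `⟨u,v⟩ = Re (u ⬝ conj v)` on `ℂⁿ`. -/
def realInner {n : ℕ} (u v : EuclideanSpace ℂ (Fin n)) : ℝ :=
  (inner ℂ u v : ℂ).re

/-- The standard symplectic form `ω₀(u,v) = ⟨iu, v⟩` on `ℂⁿ`. -/
def omega0 {n : ℕ} (u v : EuclideanSpace ℂ (Fin n)) : ℝ :=
  realInner (Complex.I • u) v

lemma realInner_sub_left {n : ℕ} (u v w : EuclideanSpace ℂ (Fin n)) :
    realInner (u - v) w = realInner u w - realInner v w := by
  simp [realInner]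

lemma eq_zero_of_realInner_self {n : ℕ} {u : EuclideanSpace ℂ (Fin n)}
    (h : realInner u u = 0) : u = 0 := by
  have hre : RCLike.re (inner ℂ u u) = 0 := h
  rw [inner_self_eq_norm_sq] at hre
  simpa using hre

/-- A complex-linear symplectic map preserves the real inner product. -/
lemma realInner_map_map {n : ℕ}
    (A : EuclideanSpace ℂ (Fin n) →L[ℝ] EuclideanSpace ℂ (Fin n))
    (hI : ∀ v, A (I • v) = I • A v) (hA : ∀ v w, omega0 (A v) (A w) = omega0 v w)
    (v w : EuclideanSpace ℂ (Fin n)) : realInner (A v) (A w) = realInner v w := by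
  have h := hA (-(I • v)) w
  simpa [omega0, hI, smul_smul] using h

lemma surjective_of_realInner_map_map {n : ℕ}
    (A : EuclideanSpace ℂ (Fin n) →L[ℝ] EuclideanSpace ℂ (Fin n))
    (hA : ∀ v w, realInner (A v) (A w) = realInner v w) : Function.Surjective A := by
  have hinj : Function.Injective A.toLinearMap := by
    rw [injective_iff_map_eq_zero]
    intro v hv
    have hv' : A v = 0 := hv
    refine eq_zero_of_realInner_self ?_
    rw [← hA, hv']
    simp [realInner]
  have : FiniteDimensional ℝ (EuclideanSpace ℂ (Fin n)) := FiniteDimensional.complexToReal _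
  exact LinearMap.injective_iff_surjective.mp hinj

/-- If `w` represents `v ↦ ⟨g, A v⟩` for an isometry `A`, then `A w = g`. -/
lemma map_eq_of_realInner_eq {n : ℕ}
    (A : EuclideanSpace ℂ (Fin n) →L[ℝ] EuclideanSpace ℂ (Fin n))
    (hA : ∀ v w, realInner (A v) (A w) = realInner v w) {w g : EuclideanSpace ℂ (Fin n)}
    (h : ∀ v, realInner w v = realInner g (A v)) : A w = g := by
  obtain ⟨v, hv⟩ := surjective_of_realInner_map_map A hA (A w - g)
  refine sub_eq_zero.mp (eq_zero_of_realInner_self ?_)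
  nth_rewrite 2 [← hv]
  rw [realInner_sub_left, hA, h, sub_self]

/-- The derivative of `τ ↦ ψ (a τ) (c τ)` for a jointly differentiable family `ψ`. -/
lemma hasDerivAt_family_comp {E : Type*} [NormedAddCommGroup E] [NormedSpace ℝ E]
    {ψ : ℝ → E → E} (hψ : Differentiable ℝ (fun p : ℝ × E => ψ p.1 p.2))
    {a : ℝ → ℝ} {c : ℝ → E} {t a' : ℝ} {c' X : E} (ha : HasDerivAt a a' t)
    (hc : HasDerivAt c c' t) (hX : HasDerivAt (fun τ => ψ τ (c t)) X (a t)) :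
    HasDerivAt (fun τ => ψ (a τ) (c τ)) (a' • X + fderiv ℝ (ψ (a t)) (c t) c') t := by
  set L := fderiv ℝ (fun p : ℝ × E => ψ p.1 p.2) (a t, c t)
  have hL : HasFDerivAt (fun p : ℝ × E => ψ p.1 p.2) L (a t, c t) :=
    (hψ (a t, c t)).hasFDerivAt
  have hLX : L (1, 0) = X := by
    have h := hL.comp_hasDerivAt (a t)
      ((hasDerivAt_id' (a t)).prodMk (hasDerivAt_const (a t) (c t)))
    exact h.unique hX
  have hLψ : HasFDerivAt (ψ (a t)) (L.comp (ContinuousLinearMap.inr ℝ ℝ E)) (c t) :=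
    hL.comp (c t) (hasFDerivAt_prodMk_right (a t) (c t))
  have h := hL.comp_hasDerivAt t (ha.prodMk hc)
  have hsplit : ((a', c') : ℝ × E) = a' • (1, 0) + (0, c') := by simp
  rw [hsplit, map_add, map_smul, hLX] at h
  rw [hLψ.fderiv]
  exact h

/-- Conjugating a Floer solution for `H(t,z) = G(z) + f(ψ_t⁻¹ z)` by
the (complex-linear, symplectic) Hamiltonian flow `ψ` of `G` produces a Floer solution
for the autonomous Hamiltonian `f`.  (Here `ψ_t⁻¹ = ψ_{-t}` by the group law.) -/
theorem floer_solution_conjugated_by_flow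
    (n : ℕ) (hn : 1 ≤ n)
    (G f : EuclideanSpace ℂ (Fin n) → ℝ)
    (hG : ContDiff ℝ (⊤ : ℕ∞) G) (hf : ContDiff ℝ (⊤ : ℕ∞) f)
    (gradG gradf : EuclideanSpace ℂ (Fin n) → EuclideanSpace ℂ (Fin n))
    (hgradG : ∀ z v, fderiv ℝ G z v = realInner (gradG z) v)
    (hgradf : ∀ z v, fderiv ℝ f z v = realInner (gradf z) v)
    -- the Hamiltonian flow ψ of G
    (ψ : ℝ → EuclideanSpace ℂ (Fin n) → EuclideanSpace ℂ (Fin n))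
    (hψsmooth : ContDiff ℝ (⊤ : ℕ∞) (fun p : ℝ × EuclideanSpace ℂ (Fin n) => ψ p.1 p.2))
    (hψ0 : ∀ z, ψ 0 z = z)
    (hψgrp : ∀ s t : ℝ, ∀ z, ψ (s + t) z = ψ s (ψ t z))
    (hψbij : ∀ t : ℝ, Function.Bijective (ψ t))
    (hψflow : ∀ t : ℝ, ∀ z, HasDerivAt (fun τ => ψ τ z) (Complex.I • gradG (ψ t z)) t)
    -- the differential of ψ_t is complex linear and symplectic
    (hψC : ∀ t : ℝ, ∀ z v, fderiv ℝ (ψ t) z (Complex.I • v) =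
      Complex.I • fderiv ℝ (ψ t) z v)
    (hψsymp : ∀ t : ℝ, ∀ z u' v',
      omega0 (fderiv ℝ (ψ t) z u') (fderiv ℝ (ψ t) z v') = omega0 u' v')
    -- the gradient of H(t,·) where H(t,z) = G(z) + f(ψ_t⁻¹ z) = G(z) + f(ψ_{-t} z)
    (gradH : ℝ → EuclideanSpace ℂ (Fin n) → EuclideanSpace ℂ (Fin n))
    (hgradH : ∀ t : ℝ, ∀ z v,
      fderiv ℝ (fun w => G w + f (ψ (-t) w)) z v = realInner (gradH t z) v)
    -- a smooth Floer solution u for H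
    (u : ℝ → ℝ → EuclideanSpace ℂ (Fin n))
    (husmooth : ContDiff ℝ (⊤ : ℕ∞) (fun p : ℝ × ℝ => u p.1 p.2))
    (hFloer : ∀ s t : ℝ,
      deriv (fun s' => u s' t) s =
        -(Complex.I •
          (deriv (fun t' => u s t') t - Complex.I • gradH t (u s t)))) :
    -- then ū(s,t) = ψ_t⁻¹(u(s,t)) = ψ_{-t}(u(s,t)) solves the Floer equation for f
    ∀ s t : ℝ,
      deriv (fun s' => ψ (-t) (u s' t)) s =
        -(Complex.I •
          (deriv (fun t' => ψ (-t') (u s t')) t -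
            Complex.I • gradf (ψ (-t) (u s t)))) := by
  intro s t
  have hΨ : Differentiable ℝ (fun p : ℝ × EuclideanSpace ℂ (Fin n) => ψ p.1 p.2) :=
    hψsmooth.differentiable (by simp)
  have hψd : ∀ τ, Differentiable ℝ (ψ τ) := fun τ =>
    hΨ.comp ((differentiable_const τ).prodMk differentiable_id)
  have hu : Differentiable ℝ (fun p : ℝ × ℝ => u p.1 p.2) := husmooth.differentiable (by simp)
  have hus : HasDerivAt (fun s' => u s' t) (deriv (fun s' => u s' t) s) s :=
    DifferentiableAt.hasDerivAt
      ((hu.comp (differentiable_id.prodMk (differentiable_const t))) s)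
  have hut : HasDerivAt (fun t' => u s t') (deriv (fun t' => u s t') t) t :=
    DifferentiableAt.hasDerivAt
      ((hu.comp ((differentiable_const s).prodMk differentiable_id)) t)
  set z := u s t with hz
  set A := fderiv ℝ (ψ (-t)) z with hAdef
  have hA : HasFDerivAt (ψ (-t)) A z := (hψd (-t) z).hasFDerivAt
  have hAI : ∀ v, A (I • v) = I • A v := hψC (-t) z
  have hAiso := realInner_map_map A hAI (hψsymp (-t) z)
  have hs : deriv (fun s' => ψ (-t) (u s' t)) s = A (deriv (fun s' => u s' t) s) :=
    (hA.comp_hasDerivAt s hus).deriv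
  have ht := (hasDerivAt_family_comp hΨ (hasDerivAt_neg t) hut (hψflow (-t) z)).deriv
  -- the flow preserves its own generating vector field
  have hXG : A (I • gradG z) = I • gradG (ψ (-t) z) := by
    have h1 : HasDerivAt (fun τ => ψ τ z) (I • gradG z) 0 := by
      simpa [hψ0] using hψflow 0 z
    have h2 : HasDerivAt (fun τ => ψ τ (ψ (-t) z)) (I • gradG (ψ (-t) z)) 0 := by
      simpa [hψ0] using hψflow 0 (ψ (-t) z)
    have hA0 : HasFDerivAt (ψ (-t)) A (ψ 0 z) := by rwa [hψ0]
    have h3 := hA0.comp_hasDerivAt 0 h1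
    refine h3.unique (h2.congr_of_eventuallyEq (Filter.Eventually.of_forall fun τ => ?_))
    simp only [Function.comp_apply]
    rw [← hψgrp, ← hψgrp, add_comm]
  have hgrad : A (gradH t z - gradG z) = gradf (ψ (-t) z) := by
    refine map_eq_of_realInner_eq A hAiso fun v => ?_
    have hGz : HasFDerivAt G (fderiv ℝ G z) z :=
      (hG.differentiable (by simp) z).hasFDerivAt
    have hfz : HasFDerivAt f (fderiv ℝ f (ψ (-t) z)) (ψ (-t) z) :=
      (hf.differentiable (by simp) _).hasFDerivAt
    have h := hgradH t z v
    have hH : HasFDerivAt (fun w => G w + f (ψ (-t) w))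
        (fderiv ℝ G z + (fderiv ℝ f (ψ (-t) z)).comp A) z := hGz.add (hfz.comp z hA)
    rw [hH.fderiv] at h
    simp only [add_apply, ContinuousLinearMap.comp_apply, hgradG,
      hgradf] at h
    rw [realInner_sub_left, ← h, add_sub_cancel_left]
  have hgradH' : A (gradH t z) = A (gradG z) + gradf (ψ (-t) z) := by
    rw [← hgrad, map_sub, add_sub_cancel]
  rw [hs, ht, hFloer, ← hXG]
  simp only [map_neg, map_sub, hAI, hgradH', ← hz, ← hAdef, neg_smul, one_smul, smul_add]
  congr 2
  abel
end
end

section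
/- Let H : ℝ × ℂ^n → ℝ be smooth with H(t+1, z) = H(t,z), and let u : ℝ² → ℂ^n be smooth with u(s, t+1) = u(s,t) for all s,t, solving the Floer equation for H. Define the action 𝒜(s) = ∫₀¹ ( ½⟨i·u(s,t), ∂_t u(s,t)⟩ − H(t, u(s,t)) ) dt. Then 𝒜 is differentiable with 𝒜'(s) = ∫₀¹ ‖∂_s u(s,t)‖² dt ≥ 0; in particular, for all s₀ ≤ s₁ the energy identity ∫_{s₀}^{s₁} ∫₀¹ ‖∂_s u(s,t)‖² dt ds = 𝒜(s₁) − 𝒜(s₀) holds. -/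
noncomputable section

open Complex

section PartialDerivatives

variable {E : Type*} [NormedAddCommGroup E] [NormedSpace ℝ E] {u : ℝ → ℝ → E}

theorem HasFDerivAt.hasDerivAt_fst {f : ℝ × ℝ → E} {f' : ℝ × ℝ →L[ℝ] E} {s t : ℝ}
    (hf : HasFDerivAt f f' (s, t)) : HasDerivAt (fun s' => f (s', t)) (f' (1, 0)) s := by
  have h : HasDerivAt (fun s' : ℝ => (s', t)) ((1, 0) : ℝ × ℝ) s :=
    (hasDerivAt_id s).prodMk (hasDerivAt_const s t)
  exact hf.comp_hasDerivAt s h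

theorem HasFDerivAt.hasDerivAt_snd {f : ℝ × ℝ → E} {f' : ℝ × ℝ →L[ℝ] E} {s t : ℝ}
    (hf : HasFDerivAt f f' (s, t)) : HasDerivAt (fun t' => f (s, t')) (f' (0, 1)) t := by
  have h : HasDerivAt (fun t' : ℝ => (s, t')) ((0, 1) : ℝ × ℝ) t :=
    (hasDerivAt_const t s).prodMk (hasDerivAt_id t)
  exact hf.comp_hasDerivAt t h

theorem hasDerivAt_fst_of_contDiff
    (hu : ContDiff ℝ 1 (fun p : ℝ × ℝ => u p.1 p.2)) (s t : ℝ) :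
    HasDerivAt (fun s' => u s' t)
      (fderiv ℝ (fun p : ℝ × ℝ => u p.1 p.2) (s, t) (1, 0)) s :=
  (hu.differentiable one_ne_zero (s, t)).hasFDerivAt.hasDerivAt_fst

theorem hasDerivAt_snd_of_contDiff
    (hu : ContDiff ℝ 1 (fun p : ℝ × ℝ => u p.1 p.2)) (s t : ℝ) :
    HasDerivAt (fun t' => u s t')
      (fderiv ℝ (fun p : ℝ × ℝ => u p.1 p.2) (s, t) (0, 1)) t :=
  (hu.differentiable one_ne_zero (s, t)).hasFDerivAt.hasDerivAt_snd

theorem contDiff_deriv_fst {k : ℕ}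
    (hu : ContDiff ℝ (k + 1) (fun p : ℝ × ℝ => u p.1 p.2)) :
    ContDiff ℝ k (fun p : ℝ × ℝ => deriv (fun s' => u s' p.2) p.1) := by
  have h1 : ContDiff ℝ 1 (fun p : ℝ × ℝ => u p.1 p.2) := hu.of_le (by simp)
  simp only [fun p : ℝ × ℝ => (hasDerivAt_fst_of_contDiff h1 p.1 p.2).deriv]
  exact (hu.fderiv_right le_rfl).clm_apply contDiff_const

theorem contDiff_deriv_snd {k : ℕ}
    (hu : ContDiff ℝ (k + 1) (fun p : ℝ × ℝ => u p.1 p.2)) :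
    ContDiff ℝ k (fun p : ℝ × ℝ => deriv (fun t' => u p.1 t') p.2) := by
  have h1 : ContDiff ℝ 1 (fun p : ℝ × ℝ => u p.1 p.2) := hu.of_le (by simp)
  simp only [fun p : ℝ × ℝ => (hasDerivAt_snd_of_contDiff h1 p.1 p.2).deriv]
  exact (hu.fderiv_right le_rfl).clm_apply contDiff_const

/-- Symmetry of mixed partial derivatives. -/
theorem deriv_deriv_comm_of_contDiff
    (hu : ContDiff ℝ 2 (fun p : ℝ × ℝ => u p.1 p.2)) (s t : ℝ) :
    deriv (fun s' => deriv (fun t' => u s' t') t) s =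
      deriv (fun t' => deriv (fun s' => u s' t') s) t := by
  have h1 : ContDiff ℝ 1 (fun p : ℝ × ℝ => u p.1 p.2) := hu.of_le (by norm_num)
  have hd := ((hu.fderiv_right (m := 1) (by norm_num)).differentiable one_ne_zero
    (s, t)).hasFDerivAt
  have hs := hd.hasDerivAt_fst.clm_apply (hasDerivAt_const s ((0, 1) : ℝ × ℝ))
  have ht := hd.hasDerivAt_snd.clm_apply (hasDerivAt_const t ((1, 0) : ℝ × ℝ))
  have es : (fun s' => deriv (fun t' => u s' t') t) = fun s' =>
      fderiv ℝ (fun p : ℝ × ℝ => u p.1 p.2) (s', t) (0, 1) :=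
    funext fun s' => (hasDerivAt_snd_of_contDiff h1 s' t).deriv
  have et : (fun t' => deriv (fun s' => u s' t') s) = fun t' =>
      fderiv ℝ (fun p : ℝ × ℝ => u p.1 p.2) (s, t') (1, 0) :=
    funext fun t' => (hasDerivAt_fst_of_contDiff h1 s t').deriv
  rw [es, et]
  refine hs.deriv.trans (Eq.trans ?_ ht.deriv.symm)
  simpa using (hu.contDiffAt.isSymmSndFDerivAt (x := (s, t)) (by simp)).eq (1, 0) (0, 1)

/-- Differentiation under the integral sign over a compact interval for `C¹` integrands. -/
theorem hasDerivAt_intervalIntegral_of_contDiff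
    (hu : ContDiff ℝ 1 (fun p : ℝ × ℝ => u p.1 p.2)) (a b s : ℝ) :
    HasDerivAt (fun s' => ∫ t in a..b, u s' t)
      (∫ t in a..b, deriv (fun s' => u s' t) s) s := by
  have hc : Continuous (fun p : ℝ × ℝ => deriv (fun s' => u s' p.2) p.1) :=
    (contDiff_deriv_fst (k := 0) (by simpa using hu)).continuous
  have hslice (x : ℝ) : Continuous (u x) := hu.continuous.comp (Continuous.prodMk_right x)
  have hslice' (x : ℝ) : Continuous (fun t => deriv (fun s' => u s' t) x) :=
    hc.comp (Continuous.prodMk_right x)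
  obtain ⟨C, hC⟩ := ((isCompact_closedBall s 1).prod (isCompact_uIcc (a := a) (b := b)))
    |>.exists_bound_of_continuousOn hc.continuousOn
  refine (intervalIntegral.hasDerivAt_integral_of_dominated_loc_of_deriv_le
    (F' := fun x t => deriv (fun s' => u s' t) x) (bound := fun _ => C)
    (Metric.closedBall_mem_nhds s one_pos)
    (Filter.Eventually.of_forall fun x => (hslice x).aestronglyMeasurable)
    ((hslice s).intervalIntegrable _ _) (hslice' s).aestronglyMeasurable
    (Filter.Eventually.of_forall fun t ht x hx => ?_) intervalIntegrable_const
    (Filter.Eventually.of_forall fun t _ x _ => ?_)).2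
  · exact hC (x, t) ⟨hx, Set.uIoc_subset_uIcc ht⟩
  · exact (hasDerivAt_fst_of_contDiff hu x t).differentiableAt.hasDerivAt

end PartialDerivatives

section Action

variable {E : Type*} [NormedAddCommGroup E] [InnerProductSpace ℝ E]

/-- The `s`-derivative of the action density along a Floer solution is the energy density up to a
total `t`-derivative. -/
theorem hasDerivAt_actionDensity (J : E →L[ℝ] E)
    (hJ : ∀ x y, inner ℝ (J x) y = -inner ℝ x (J y))
    {H : ℝ → E → ℝ} {gradH : ℝ → E → E}
    (hH : ∀ t z, HasFDerivAt (H t) (innerSL ℝ (gradH t z)) z)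
    {u : ℝ → ℝ → E} (hu : ContDiff ℝ 2 (fun p : ℝ × ℝ => u p.1 p.2)) {s t : ℝ}
    (hFloer : deriv (fun s' => u s' t) s =
      -J (deriv (fun t' => u s t') t) - gradH t (u s t)) :
    HasDerivAt
      (fun s' => (1 : ℝ) / 2 * inner ℝ (J (u s' t)) (deriv (fun t' => u s' t') t) - H t (u s' t))
      (‖deriv (fun s' => u s' t) s‖ ^ 2 +
        1 / 2 * deriv (fun t' => inner ℝ (J (u s t')) (deriv (fun s' => u s' t') s)) t) s := by
  have h1 : ContDiff ℝ 1 (fun p : ℝ × ℝ => u p.1 p.2) := hu.of_le (by norm_num)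
  have hus := (hasDerivAt_fst_of_contDiff h1 s t).differentiableAt.hasDerivAt
  have hut := (hasDerivAt_snd_of_contDiff h1 s t).differentiableAt.hasDerivAt
  have hts := (hasDerivAt_fst_of_contDiff (u := fun s t => deriv (fun t' => u s t') t)
    (contDiff_deriv_snd (k := 1) (by exact_mod_cast hu)) s t).differentiableAt.hasDerivAt
  have hst := (hasDerivAt_snd_of_contDiff (u := fun s t => deriv (fun s' => u s' t) s)
    (contDiff_deriv_fst (k := 1) (by exact_mod_cast hu)) s t).differentiableAt.hasDerivAt
  have hB := ((J.hasFDerivAt.comp_hasDerivAt t hut).inner ℝ hst).deriv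
  have hA := (((J.hasFDerivAt.comp_hasDerivAt s hus).inner ℝ hts).const_mul (1 / 2 : ℝ)).sub
    ((hH t (u s t)).comp_hasDerivAt s hus)
  refine hA.congr_deriv ?_
  refine Eq.trans ?_ (congrArg (fun x => _ + 1 / 2 * x) hB.symm)
  rw [deriv_deriv_comm_of_contDiff hu, ← real_inner_self_eq_norm_sq, innerSL_apply_apply]
  set a := deriv (fun s' => u s' t) s
  set b := deriv (fun t' => u s t') t
  have hg : gradH t (u s t) = -J b - a := by rw [hFloer]; abel
  rw [hg, inner_sub_left, inner_neg_left, hJ a b, real_inner_comm (J b) a]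
  simp only [Function.comp_apply]
  ring

theorem hasDerivAt_action (J : E →L[ℝ] E)
    (hJ : ∀ x y, inner ℝ (J x) y = -inner ℝ x (J y))
    {H : ℝ → E → ℝ} (hHs : ContDiff ℝ 1 (fun p : ℝ × E => H p.1 p.2)) {gradH : ℝ → E → E}
    (hH : ∀ t z, HasFDerivAt (H t) (innerSL ℝ (gradH t z)) z)
    {u : ℝ → ℝ → E} (hu : ContDiff ℝ 2 (fun p : ℝ × ℝ => u p.1 p.2)) {T : ℝ}
    (huper : ∀ s t, u s (t + T) = u s t)
    (hFloer : ∀ s t, deriv (fun s' => u s' t) s =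
      -J (deriv (fun t' => u s t') t) - gradH t (u s t)) (s : ℝ) :
    HasDerivAt
      (fun s' => ∫ t in (0 : ℝ)..T,
        ((1 : ℝ) / 2 * inner ℝ (J (u s' t)) (deriv (fun t' => u s' t') t) - H t (u s' t)))
      (∫ t in (0 : ℝ)..T, ‖deriv (fun s' => u s' t) s‖ ^ 2) s := by
  have h1 : ContDiff ℝ 1 (fun p : ℝ × ℝ => u p.1 p.2) := hu.of_le (by norm_num)
  have hus : ContDiff ℝ 1 (fun p : ℝ × ℝ => deriv (fun s' => u s' p.2) p.1) :=
    contDiff_deriv_fst (k := 1) (by exact_mod_cast hu)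
  have hut : ContDiff ℝ 1 (fun p : ℝ × ℝ => deriv (fun t' => u p.1 t') p.2) :=
    contDiff_deriv_snd (k := 1) (by exact_mod_cast hu)
  have hJu : ContDiff ℝ 1 (fun p : ℝ × ℝ => J (u p.1 p.2)) := J.contDiff.comp h1
  have hG : ContDiff ℝ 1 (fun p : ℝ × ℝ => (1 : ℝ) / 2 *
      inner ℝ (J (u p.1 p.2)) (deriv (fun t' => u p.1 t') p.2) - H p.2 (u p.1 p.2)) :=
    (contDiff_const.mul (hJu.inner ℝ hut)).sub (hHs.comp (contDiff_snd.prodMk h1))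
  have hK : ContDiff ℝ 1 (fun t => (inner ℝ (J (u s t)) (deriv (fun s' => u s' t) s) : ℝ)) :=
    (hJu.inner ℝ hus).comp (contDiff_const.prodMk contDiff_id : ContDiff ℝ 1 fun t => (s, t))
  have hKc : Continuous
      (deriv fun t => (inner ℝ (J (u s t)) (deriv (fun s' => u s' t) s) : ℝ)) :=
    hK.continuous_deriv le_rfl
  have hKint : ∫ t in (0 : ℝ)..T,
      deriv (fun t => (inner ℝ (J (u s t)) (deriv (fun s' => u s' t) s) : ℝ)) t = 0 := by
    rw [intervalIntegral.integral_deriv_eq_sub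
      (fun t _ => hK.differentiable one_ne_zero t) (hKc.intervalIntegrable _ _)]
    have hper : ∀ s', u s' T = u s' 0 := fun s' => by simpa using huper s' 0
    simp only [hper, sub_self]
  have hE : Continuous (fun t => ‖deriv (fun s' => u s' t) s‖ ^ 2) :=
    (hus.continuous.comp (Continuous.prodMk_right s)).norm.pow 2
  refine (hasDerivAt_intervalIntegral_of_contDiff hG 0 T s).congr_deriv ?_
  simp only [fun t => (hasDerivAt_actionDensity J hJ hH hu (hFloer s t)).deriv]
  rw [intervalIntegral.integral_add (hE.intervalIntegrable _ _)
      ((hKc.const_mul _).intervalIntegrable _ _),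
    intervalIntegral.integral_const_mul, hKint, mul_zero, add_zero]

end Action

theorem realInner_eq_inner {n : ℕ} (x y : EuclideanSpace ℂ (Fin n)) :
    realInner x y = inner ℝ x y := by
  simp [realInner, PiLp.inner_apply, Complex.inner]

/-- For a (1-periodically) time-dependent Hamiltonian `H` and a
smooth `t`-periodic Floer solution `u`, the action
`𝒜(s) = ∫₀¹ (½⟨i u, ∂ₜu⟩ − H(t,u)) dt` is differentiable with
`𝒜'(s) = ∫₀¹ ‖∂ₛu‖² dt ≥ 0`, and the energy identity
`∫_{s₀}^{s₁}∫₀¹ ‖∂ₛu‖² dt ds = 𝒜(s₁) − 𝒜(s₀)` holds. -/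
theorem floer_energy_identity
    (n : ℕ) (hn : 1 ≤ n)
    (H : ℝ → EuclideanSpace ℂ (Fin n) → ℝ)
    (hHsmooth : ContDiff ℝ (⊤ : ℕ∞) (fun p : ℝ × EuclideanSpace ℂ (Fin n) => H p.1 p.2))
    (hHper : ∀ t : ℝ, ∀ z, H (t + 1) z = H t z)
    -- the gradient of H(t,·)
    (gradH : ℝ → EuclideanSpace ℂ (Fin n) → EuclideanSpace ℂ (Fin n))
    (hgradH : ∀ t : ℝ, ∀ z v, fderiv ℝ (H t) z v = realInner (gradH t z) v)
    -- a smooth t-periodic Floer solution u for H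
    (u : ℝ → ℝ → EuclideanSpace ℂ (Fin n))
    (husmooth : ContDiff ℝ (⊤ : ℕ∞) (fun p : ℝ × ℝ => u p.1 p.2))
    (huper : ∀ s t : ℝ, u s (t + 1) = u s t)
    (hFloer : ∀ s t : ℝ,
      deriv (fun s' => u s' t) s =
        -(Complex.I •
          (deriv (fun t' => u s t') t - Complex.I • gradH t (u s t)))) :
    (∀ s : ℝ,
      HasDerivAt
        (fun s' => ∫ t in (0 : ℝ)..1,
          ((1 : ℝ) / 2 * realInner (Complex.I • u s' t) (deriv (fun t' => u s' t') t)
            - H t (u s' t)))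
        (∫ t in (0 : ℝ)..1, ‖deriv (fun s' => u s' t) s‖ ^ 2) s ∧
      0 ≤ ∫ t in (0 : ℝ)..1, ‖deriv (fun s' => u s' t) s‖ ^ 2) ∧
    (∀ s₀ s₁ : ℝ, s₀ ≤ s₁ →
      (∫ s in s₀..s₁, ∫ t in (0 : ℝ)..1, ‖deriv (fun s' => u s' t) s‖ ^ 2) =
        (∫ t in (0 : ℝ)..1,
          ((1 : ℝ) / 2 * realInner (Complex.I • u s₁ t) (deriv (fun t' => u s₁ t') t)
            - H t (u s₁ t))) -
        (∫ t in (0 : ℝ)..1,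
          ((1 : ℝ) / 2 * realInner (Complex.I • u s₀ t) (deriv (fun t' => u s₀ t') t)
            - H t (u s₀ t)))) := by
  let J : EuclideanSpace ℂ (Fin n) →L[ℝ] EuclideanSpace ℂ (Fin n) :=
    (Complex.I • ContinuousLinearMap.id ℂ (EuclideanSpace ℂ (Fin n))).restrictScalars ℝ
  have hJ (x y : EuclideanSpace ℂ (Fin n)) : inner ℝ (J x) y = -inner ℝ x (J y) := by
    change inner ℝ (Complex.I • x) y = -inner ℝ x (Complex.I • y)
    rw [← realInner_eq_inner, ← realInner_eq_inner]
    simp only [realInner, inner_smul_left, inner_smul_right]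
    simp
  have hH (t : ℝ) (z : EuclideanSpace ℂ (Fin n)) :
      HasFDerivAt (H t) (innerSL ℝ (gradH t z)) z := by
    have hHt : ContDiff ℝ (⊤ : ℕ∞) (H t) :=
      hHsmooth.comp (contDiff_const.prodMk contDiff_id : ContDiff ℝ (⊤ : ℕ∞) fun z => (t, z))
    refine (hHt.differentiable (by simp) z).hasFDerivAt.congr_fderiv ?_
    ext v
    rw [hgradH, realInner_eq_inner, innerSL_apply_apply]
  have hu : ContDiff ℝ 2 (fun p : ℝ × ℝ => u p.1 p.2) :=
    husmooth.of_le (WithTop.coe_le_coe.2 le_top)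
  have hF (s t : ℝ) : deriv (fun s' => u s' t) s =
      -J (deriv (fun t' => u s t') t) - gradH t (u s t) := by
    rw [hFloer]
    change _ = -(Complex.I • (deriv (fun t' => u s t') t)) - gradH t (u s t)
    rw [smul_sub, smul_smul, Complex.I_mul_I, neg_one_smul]
    abel
  have hA (s : ℝ) := hasDerivAt_action J hJ (hHsmooth.of_le (by exact_mod_cast le_top)) hH hu
    huper hF s
  simp only [← realInner_eq_inner] at hA
  have hus : Continuous (fun p : ℝ × ℝ => ‖deriv (fun s' => u s' p.2) p.1‖ ^ 2) :=
    (contDiff_deriv_fst (k := 1) (by exact_mod_cast hu)).continuous.norm.pow 2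
  refine ⟨fun s => ⟨hA s, intervalIntegral.integral_nonneg zero_le_one fun t _ => by positivity⟩,
    fun s₀ s₁ _ => ?_⟩
  refine intervalIntegral.integral_eq_sub_of_hasDerivAt (fun s _ => hA s)
    (Continuous.intervalIntegrable ?_ _ _)
  exact intervalIntegral.continuous_parametric_intervalIntegral_of_continuous' hus 0 1
end
end
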